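/- arXiv:1711.06937 — 2 statements merged into one kernel-verified Lean document; each statement's English description precedes it below -/
import Mathlib

section
/- Let n ≥ 4 be an even integer, let h > 0 be a real number, and let t₁, …, tₙ be reals with 0 < t₁ ≤ t₂ ≤ ⋯ ≤ tₙ and t_{n/2} ≤ h·t₁. Then Σ_{k=2}^{n} (1/t₁)·∫₀^{t₁} ∫₀^{y} ∏_{i ∈ {2,…,n}, i ≠ k} (1 − x/tᵢ) dx dy ≤ 2h·t₁. -/
open MeasureTheory Finset

/-- The contribution of machines 2,…,n to the expected social cost of Koutsoupias's
truthful scheduling mechanism on a nondecreasingly sorted input `s`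
(index `⟨0, hn⟩` plays the role of machine 1). -/
noncomputable def SCMtail {n : ℕ} (s : Fin n → ℝ) (hn : 0 < n) : ℝ :=
  ∑ k ∈ Finset.univ.filter (fun k => k ≠ (⟨0, hn⟩ : Fin n)),
    (1 / s ⟨0, hn⟩) *
      ∫ y in (0:ℝ)..(s ⟨0, hn⟩), ∫ x in (0:ℝ)..y,
        ∏ i ∈ Finset.univ.filter (fun i => i ≠ (⟨0, hn⟩ : Fin n) ∧ i ≠ k), (1 - x / s i)

theorem integral_one_sub_div_pow_le (H y : ℝ) (hH : 0 < H) (hyH : y ≤ H) (r : ℕ) :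
    ∫ x in (0:ℝ)..y, (1 - x / H) ^ r ≤ H / (r + 1) := by
  have hr : (r : ℝ) + 1 ≠ 0 := by positivity
  have hderiv : ∀ x ∈ Set.uIcc 0 y,
      HasDerivAt (fun x : ℝ => -(H / (r + 1)) * (1 - x / H) ^ (r + 1)) ((1 - x / H) ^ r) x := by
    intro x _
    have h₁ := ((((hasDerivAt_id x).div_const H).const_sub 1).pow (r + 1)).const_mul (-(H / (r + 1)))
    refine h₁.congr_deriv ?_
    simp only [id, Nat.add_sub_cancel]
    push_cast
    field_simp
  rw [intervalIntegral.integral_eq_sub_of_hasDerivAt hderiv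
    ((by fun_prop : Continuous fun x : ℝ => (1 - x / H) ^ r).intervalIntegrable _ _)]
  have hle : 0 ≤ 1 - y / H := sub_nonneg.2 ((div_le_one hH).2 hyH)
  have : 0 ≤ H / (r + 1) * (1 - y / H) ^ (r + 1) := by positivity
  simp only [zero_div, sub_zero, one_pow]
  linarith

theorem integral_prod_one_sub_div_le {ι : Type*} (S T : Finset ι) (hTS : T ⊆ S) (s : ι → ℝ)
    (H y : ℝ) (hy : 0 ≤ y) (hH : 0 < H) (hyH : y ≤ H) (hs : ∀ i ∈ S, 0 < s i)
    (hys : ∀ i ∈ S, y ≤ s i) (hsH : ∀ i ∈ T, s i ≤ H) :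
    ∫ x in (0:ℝ)..y, ∏ i ∈ S, (1 - x / s i) ≤ H / (T.card + 1) := by
  refine le_trans (intervalIntegral.integral_mono_on hy
    ((by fun_prop : Continuous fun x : ℝ => ∏ i ∈ S, (1 - x / s i)).intervalIntegrable _ _)
    ((by fun_prop : Continuous fun x : ℝ => (1 - x / H) ^ T.card).intervalIntegrable _ _) ?_)
    (integral_one_sub_div_pow_le H y hH hyH T.card)
  rintro x ⟨hx0, hxy⟩
  have h0 : ∀ i ∈ S, 0 ≤ 1 - x / s i := fun i hi =>
    sub_nonneg.2 ((div_le_one (hs i hi)).2 (hxy.trans (hys i hi)))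
  have h1 : ∀ i ∈ S, 1 - x / s i ≤ 1 := fun i hi =>
    sub_le_self _ (div_nonneg hx0 (hs i hi).le)
  calc ∏ i ∈ S, (1 - x / s i) ≤ ∏ i ∈ T, (1 - x / s i) :=
        Finset.prod_le_prod_of_subset_of_le_one hTS h0 fun i hi _ => h1 i hi
    _ ≤ ∏ _i ∈ T, (1 - x / H) := by
        refine Finset.prod_le_prod (fun i hi => h0 i (hTS hi)) fun i hi => ?_
        have := div_le_div_of_nonneg_left hx0 (hs i (hTS hi)) (hsH i hi)
        linarith
    _ = (1 - x / H) ^ T.card := Finset.prod_const _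

theorem average_integral_prod_one_sub_div_le {ι : Type*} (S T : Finset ι) (hTS : T ⊆ S)
    (s : ι → ℝ) (a H : ℝ) (ha : 0 < a) (haH : a ≤ H) (has : ∀ i ∈ S, a ≤ s i)
    (hsH : ∀ i ∈ T, s i ≤ H) :
    (1 / a) * ∫ y in (0:ℝ)..a, ∫ x in (0:ℝ)..y, ∏ i ∈ S, (1 - x / s i) ≤ H / (T.card + 1) := by
  have hc : Continuous fun x : ℝ => ∏ i ∈ S, (1 - x / s i) := by fun_prop
  have hbound : ∫ y in (0:ℝ)..a, ∫ x in (0:ℝ)..y, ∏ i ∈ S, (1 - x / s i)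
      ≤ ∫ _y in (0:ℝ)..a, H / (T.card + 1) := by
    refine intervalIntegral.integral_mono_on ha.le
      ((intervalIntegral.continuous_primitive (fun b c => hc.intervalIntegrable b c)
        0).intervalIntegrable _ _) intervalIntegrable_const ?_
    rintro y ⟨hy0, hya⟩
    exact integral_prod_one_sub_div_le S T hTS s H y hy0 (ha.trans_le haH) (hya.trans haH)
      (fun i hi => ha.trans_le (has i hi)) (fun i hi => hya.trans (has i hi)) hsH
  rw [intervalIntegral.integral_const, smul_eq_mul, sub_zero] at hbound
  rw [one_div, inv_mul_le_iff₀ ha]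
  exact hbound

theorem tail_cost_bound_under_event_A
    (n : ℕ) (hn4 : 4 ≤ n) (hne : Even n) (h : ℝ) (hh : 0 < h)
    (t : Fin n → ℝ) (hpos : 0 < t ⟨0, by omega⟩) (hmono : Monotone t)
    (hA : t ⟨n / 2 - 1, by omega⟩ ≤ h * t ⟨0, by omega⟩) :
    SCMtail t (by omega) ≤ 2 * h * t ⟨0, by omega⟩ := by
  obtain ⟨m, rfl⟩ := hne
  obtain ⟨p, rfl⟩ : ∃ p, m = p + 2 := ⟨m - 2, by omega⟩
  set o : Fin (p + 2 + (p + 2)) := ⟨0, by omega⟩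
  set q : Fin (p + 2 + (p + 2)) := ⟨(p + 2 + (p + 2)) / 2 - 1, by omega⟩ with hq
  set H := h * t o with hHdef
  have hqv : q.val = p + 1 := by simp only [hq]; omega
  have hmin : ∀ i, t o ≤ t i := fun i => hmono (Fin.mk_le_of_le_val (Nat.zero_le _))
  have haH : t o ≤ H := (hmin q).trans hA
  set U := Finset.Ioc o q with hU
  have hUcard : U.card = p + 1 := by
    rw [hU, Fin.card_Ioc, hqv]; rfl
  have hUne : ∀ i ∈ U, i ≠ o := fun i hi => (Finset.mem_Ioc.1 hi).1.ne'
  have hterm : ∀ k, (1 / t o) * ∫ y in (0:ℝ)..(t o), ∫ x in (0:ℝ)..y,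
      ∏ i ∈ Finset.univ.filter (fun i => i ≠ o ∧ i ≠ k), (1 - x / t i)
        ≤ H / ((U.erase k).card + 1) := by
    intro k
    refine average_integral_prod_one_sub_div_le _ (U.erase k) ?_ t (t o) H hpos haH
      (fun i _ => hmin i) fun i hi => ?_
    · intro i hi
      obtain ⟨hik, hiU⟩ := Finset.mem_erase.1 hi
      simpa using ⟨hUne i hiU, hik⟩
    · exact (hmono (Finset.mem_Ioc.1 (Finset.mem_of_mem_erase hi)).2).trans hA
  have hsub : U ⊆ Finset.univ.filter (fun k => k ≠ o) := fun i hi => by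
    simpa using hUne i hi
  have hcard : (Finset.univ.filter (fun k => k ≠ o) \ U).card = p + 2 := by
    rw [Finset.card_sdiff_of_subset hsub, hUcard, Finset.filter_ne',
      Finset.card_erase_of_mem (Finset.mem_univ _), Finset.card_univ, Fintype.card_fin]
    omega
  have hp1 : (p : ℝ) + 1 ≠ 0 := by positivity
  have hp2 : (p : ℝ) + 2 ≠ 0 := by positivity
  have hin : ∑ k ∈ U, H / (((U.erase k).card : ℝ) + 1) = H := by
    rw [Finset.sum_congr rfl fun k hk => by
      rw [Finset.card_erase_of_mem hk, hUcard, Nat.add_sub_cancel],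
      Finset.sum_const, hUcard, nsmul_eq_mul]
    push_cast
    field_simp
  have hout : ∑ k ∈ Finset.univ.filter (fun k => k ≠ o) \ U,
      H / (((U.erase k).card : ℝ) + 1) = H := by
    rw [Finset.sum_congr rfl fun k hk => by
      rw [Finset.erase_eq_of_notMem (Finset.mem_sdiff.1 hk).2, hUcard],
      Finset.sum_const, hcard, nsmul_eq_mul]
    push_cast
    rw [add_assoc, one_add_one_eq_two]
    field_simp
  calc SCMtail t _ ≤ ∑ k ∈ Finset.univ.filter (fun k => k ≠ o),
        H / (((U.erase k).card : ℝ) + 1) := Finset.sum_le_sum fun k _ => hterm k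
    _ = H + H := by rw [← Finset.sum_sdiff hsub, hin, hout]
    _ = 2 * h * t o := by rw [hHdef]; ring
end

section
/- Let n ≥ 4 be an even natural number, let t_min > 0 and h > 0 be reals with h·t_min ≥ t_min, and let μ be a Borel probability measure on ℝ supported on [t_min, ∞) with μ((−∞, h·t_min]) ≥ 11/12. Assume further the worst-case guarantee that SC_M(t) ≤ ((n + 1)/2)·minᵢ tᵢ for every t : Fin n → ℝ with all coordinates ≥ t_min. Then the average-case approximation ratio satisfies ∫ (SC_M(t) / minᵢ tᵢ) dμⁿ(t) < 2h + 1.33. -/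
open MeasureTheory Finset
open scoped ENNReal

/-- The expected social cost of Koutsoupias's truthful scheduling mechanism on a
nondecreasingly sorted input `s` (index `⟨0, hn⟩` plays the role of machine 1). -/
noncomputable def SCM {n : ℕ} (s : Fin n → ℝ) (hn : 0 < n) : ℝ :=
  (∫ y in (0:ℝ)..(s ⟨0, hn⟩),
      ∏ i ∈ Finset.univ.filter (fun i => i ≠ (⟨0, hn⟩ : Fin n)), (1 - y / s i)) +
  ∑ k ∈ Finset.univ.filter (fun k => k ≠ (⟨0, hn⟩ : Fin n)),
    (1 / s ⟨0, hn⟩) *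
      ∫ y in (0:ℝ)..(s ⟨0, hn⟩), ∫ x in (0:ℝ)..y,
        ∏ i ∈ Finset.univ.filter (fun i => i ≠ (⟨0, hn⟩ : Fin n) ∧ i ≠ k), (1 - x / s i)

/-- The expected social cost of the mechanism on a general input `t`: apply `SCM`
to the nondecreasing rearrangement of `t`. -/
noncomputable def SCMgen {n : ℕ} (t : Fin n → ℝ) (hn : 0 < n) : ℝ :=
  SCM (t ∘ Tuple.sort t) hn

lemma integral_one_sub_div_pow {a : ℝ} (ha : 0 < a) (k : ℕ) (y : ℝ) :
    ∫ x in (0 : ℝ)..y, (1 - x / a) ^ k = a / (k + 1) * (1 - (1 - y / a) ^ (k + 1)) := by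
  have hderiv : ∀ x ∈ Set.uIcc 0 y,
      HasDerivAt (fun x : ℝ => -(a / (k + 1)) * (1 - x / a) ^ (k + 1)) ((1 - x / a) ^ k) x := by
    intro x _
    refine ((((hasDerivAt_id' x).div_const a).const_sub 1).fun_pow (k + 1)).const_mul
      (-(a / ((k : ℝ) + 1))) |>.congr_deriv ?_
    have : (k : ℝ) + 1 ≠ 0 := by positivity
    push_cast [add_tsub_cancel_right]
    field_simp
  rw [intervalIntegral.integral_eq_sub_of_hasDerivAt hderiv
    (Continuous.intervalIntegrable (by fun_prop) _ _)]
  simp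
  ring

lemma prod_le_pow_of_le_card {ι : Type*} [DecidableEq ι] {S T : Finset ι} {f : ι → ℝ} {c : ℝ}
    {k : ℕ} (hTS : T ⊆ S) (hf0 : ∀ i ∈ S, 0 ≤ f i) (hf1 : ∀ i ∈ S, f i ≤ 1)
    (hfc : ∀ i ∈ T, f i ≤ c) (hc0 : 0 ≤ c) (hc1 : c ≤ 1) (hk : k ≤ T.card) :
    ∏ i ∈ S, f i ≤ c ^ k := by
  calc ∏ i ∈ S, f i ≤ ∏ i ∈ S, (if i ∈ T then c else 1) := by
        refine Finset.prod_le_prod hf0 fun i hi => ?_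
        split_ifs with hT
        · exact hfc i hT
        · exact hf1 i hi
    _ = c ^ T.card := by
        rw [← Finset.prod_filter, Finset.filter_mem_eq_inter, Finset.inter_eq_right.mpr hTS,
          Finset.prod_const]
    _ ≤ c ^ k := pow_le_pow_of_le_one hc0 hc1 hk

/-- If the fastest of `n` machines needs time `s 0` and at least `k + 2` machines need time at
most `a`, then the mechanism's cost is at most `n * a / (k + 2)`. -/
lemma SCM_le_of_le_card {n : ℕ} (hn : 0 < n) {s : Fin n → ℝ} {a : ℝ} {k : ℕ}
    (hpos : 0 < s ⟨0, hn⟩) (hmin : ∀ i, s ⟨0, hn⟩ ≤ s i) (ha : s ⟨0, hn⟩ ≤ a)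
    (hcard : k + 2 ≤ (univ.filter fun i => s i ≤ a).card) :
    SCM s hn ≤ n * (a / (k + 2)) := by
  unfold SCM
  set z : Fin n := ⟨0, hn⟩
  set m := s z
  set T := univ.filter fun i => s i ≤ a
  have ha0 : 0 < a := hpos.trans_le ha
  have hprod : ∀ (S : Finset (Fin n)) (j : ℕ) (x : ℝ), j ≤ (T ∩ S).card → 0 ≤ x → x ≤ m →
      ∏ i ∈ S, (1 - x / s i) ≤ (1 - x / a) ^ j := by
    intro S j x hj hx0 hxm
    have hs : ∀ i, 0 < s i := fun i => hpos.trans_le (hmin i)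
    refine prod_le_pow_of_le_card (T := T ∩ S) Finset.inter_subset_right ?_ ?_ ?_ ?_ ?_ hj
    · intro i _
      rw [sub_nonneg, div_le_one (hs i)]
      exact hxm.trans (hmin i)
    · intro i _
      have := div_nonneg hx0 (hs i).le
      linarith
    · intro i hi
      have hia : s i ≤ a := (Finset.mem_filter.mp (Finset.mem_inter.mp hi).1).2
      have := div_le_div_of_nonneg_left hx0 (hs i) hia
      linarith
    · rw [sub_nonneg, div_le_one ha0]
      exact hxm.trans ha
    · have := div_nonneg hx0 ha0.le
      linarith
  have hcont : ∀ S : Finset (Fin n), Continuous fun x : ℝ => ∏ i ∈ S, (1 - x / s i) := by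
    intro S
    fun_prop
  have hcm0 : 0 ≤ 1 - m / a := by
    rw [sub_nonneg, div_le_one ha0]
    exact ha
  have hcm1 : 1 - m / a ≤ 1 := by
    have := div_nonneg hpos.le ha0.le
    linarith
  have hfirst : ∫ y in (0 : ℝ)..m, ∏ i ∈ univ.filter (fun i => i ≠ z), (1 - y / s i)
      ≤ a / (k + 2) := by
    have hT : k + 1 ≤ (T ∩ univ.filter fun i => i ≠ z).card := by
      have he : T ∩ univ.filter (fun i => i ≠ z) = T.erase z := by
        ext i; simp [and_comm]
      have := Finset.pred_card_le_card_erase (s := T) (a := z)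
      rw [he]; omega
    calc _ ≤ ∫ y in (0 : ℝ)..m, (1 - y / a) ^ (k + 1) := by
          refine intervalIntegral.integral_mono_on hpos.le ((hcont _).intervalIntegrable _ _)
            (Continuous.intervalIntegrable (by fun_prop) _ _) fun y hy => ?_
          exact hprod _ _ _ hT hy.1 hy.2
      _ = a / (k + 2) * (1 - (1 - m / a) ^ (k + 2)) := by
          rw [integral_one_sub_div_pow ha0]
          push_cast
          ring
      _ ≤ a / (k + 2) :=
          mul_le_of_le_one_right (by positivity) (by linarith [pow_nonneg hcm0 (k + 2)])
  have hrest : ∀ j ∈ univ.filter (fun j => j ≠ z),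
      (1 / m) * ∫ y in (0 : ℝ)..m, ∫ x in (0 : ℝ)..y,
        ∏ i ∈ univ.filter (fun i => i ≠ z ∧ i ≠ j), (1 - x / s i) ≤ a / (k + 2) := by
    intro j _
    have hT : k ≤ (T ∩ univ.filter fun i => i ≠ z ∧ i ≠ j).card := by
      have he : T ∩ univ.filter (fun i => i ≠ z ∧ i ≠ j) = (T.erase z).erase j := by
        ext i
        simp only [Finset.mem_inter, Finset.mem_filter, Finset.mem_univ, Finset.mem_erase]
        tauto
      have h1 := Finset.pred_card_le_card_erase (s := T) (a := z)
      have h2 := Finset.pred_card_le_card_erase (s := T.erase z) (a := j)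
      rw [he]; omega
    have hbound : ∫ y in (0 : ℝ)..m, ∫ x in (0 : ℝ)..y,
        ∏ i ∈ univ.filter (fun i => i ≠ z ∧ i ≠ j), (1 - x / s i)
        ≤ ∫ y in (0 : ℝ)..m, a / (k + 1) * (1 - (1 - y / a) ^ (k + 1)) := by
      refine intervalIntegral.integral_mono_on hpos.le ?_
        (Continuous.intervalIntegrable (by fun_prop) _ _) fun y hy => ?_
      · exact (intervalIntegral.continuous_primitive
          (fun _ _ => (hcont _).intervalIntegrable _ _) 0).intervalIntegrable _ _
      · rw [← integral_one_sub_div_pow ha0]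
        refine intervalIntegral.integral_mono_on hy.1 ((hcont _).intervalIntegrable _ _)
            (Continuous.intervalIntegrable (by fun_prop) _ _) fun x hx => ?_
        exact hprod _ _ _ hT hx.1 (hx.2.trans hy.2)
    rw [intervalIntegral.integral_const_mul, intervalIntegral.integral_sub (by simp)
      (Continuous.intervalIntegrable (by fun_prop) _ _), integral_one_sub_div_pow ha0] at hbound
    have hpow : (1 - m / a) ^ (k + 2) ≤ 1 - m / a :=
      pow_le_of_le_one hcm0 hcm1 (by omega)
    rw [one_div, inv_mul_le_iff₀ hpos]
    refine hbound.trans ?_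
    have hmul : m ≤ a * (1 - (1 - m / a) ^ (k + 2)) := by
      calc m = a * (m / a) := by field_simp
        _ ≤ _ := mul_le_mul_of_nonneg_left (by linarith) ha0.le
    have hdiv : m / (k + 2) ≤ a / (k + 2) * (1 - (1 - m / a) ^ (k + 2)) := by
      rw [div_mul_eq_mul_div]
      gcongr
    calc _ = a / (k + 1) * (m - a / (k + 2) * (1 - (1 - m / a) ^ (k + 2))) := by
          simp only [intervalIntegral.integral_const, smul_eq_mul]
          push_cast
          ring
      _ ≤ a / (k + 1) * (m - m / (k + 2)) := by gcongr
      _ = m * (a / (k + 2)) := by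
          field_simp
          ring
  have hc : ((univ.filter fun j => j ≠ z).card : ℝ) = n - 1 := by
    rw [Finset.filter_ne', Finset.card_erase_of_mem (Finset.mem_univ z), Finset.card_univ,
      Fintype.card_fin, Nat.cast_sub (by omega), Nat.cast_one]
  have hsum := Finset.sum_le_card_nsmul _ _ _ hrest
  rw [nsmul_eq_mul, hc] at hsum
  linarith

lemma inf'_eq_sort_zero {n : ℕ} (hn : 0 < n) (t : Fin n → ℝ) :
    univ.inf' ⟨⟨0, hn⟩, mem_univ _⟩ t = (t ∘ Tuple.sort t) ⟨0, hn⟩ := by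
  refine le_antisymm (Finset.inf'_le t (Finset.mem_univ _)) ?_
  refine Finset.le_inf' _ _ fun i _ => ?_
  have := Tuple.monotone_sort t
    (show (⟨0, hn⟩ : Fin n) ≤ (Tuple.sort t).symm i from Nat.zero_le _)
  simpa using this

lemma SCMgen_le_of_le_card {n : ℕ} (hn : 0 < n) {t : Fin n → ℝ} {a : ℝ} {k : ℕ}
    (hpos : ∀ i, 0 < t i) (ha : univ.inf' ⟨⟨0, hn⟩, mem_univ _⟩ t ≤ a)
    (hcard : k + 2 ≤ (univ.filter fun i => t i ≤ a).card) :
    SCMgen t hn ≤ n * (a / (k + 2)) := by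
  rw [inf'_eq_sort_zero hn] at ha
  refine SCM_le_of_le_card hn (hpos _)
    (fun i => Tuple.monotone_sort t (show (⟨0, hn⟩ : Fin n) ≤ i from Nat.zero_le _)) ha
    (hcard.trans_eq ?_)
  refine (Finset.card_equiv (Tuple.sort t) fun i => ?_).symm
  simp

/-- A multiplicative majorant for the event that a strict majority of coordinates exceeds `H`. -/
lemma one_le_prod_ite_of_card_lt {n r : ℕ} (hr : n = r + r) {t : Fin n → ℝ} {H : ℝ}
    (hcard : (univ.filter fun i => t i ≤ H).card < r) :
    (1 : ℝ) ≤ ∏ i, if t i ≤ H then 1 / 3 else 3 := by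
  have hc := Finset.card_filter_add_card_filter_not (s := (univ : Finset (Fin n)))
    (fun i => t i ≤ H)
  rw [Finset.card_univ, Fintype.card_fin] at hc
  rw [Finset.prod_ite, Finset.prod_const, Finset.prod_const, one_div, inv_pow,
    inv_mul_eq_div, one_le_div (by positivity)]
  exact pow_le_pow_right₀ (by norm_num) (by omega)

lemma integral_ite_Iic_le {μ : Measure ℝ} [IsProbabilityMeasure μ] {H : ℝ}
    (hH : (11 / 12 : ℝ≥0∞) ≤ μ (Set.Iic H)) :
    ∫ x, (if x ≤ H then 1 / 3 else 3 : ℝ) ∂μ ≤ 5 / 9 := by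
  have hfun : (fun x : ℝ => (if x ≤ H then 1 / 3 else 3 : ℝ)) =
      fun x => 3 - (Set.Iic H).indicator (fun _ => (8 / 3 : ℝ)) x := by
    funext x
    by_cases hx : x ≤ H <;> simp [hx]
    norm_num
  have hreal : (11 / 12 : ℝ) ≤ μ.real (Set.Iic H) := by
    have := ENNReal.toReal_mono (measure_ne_top μ _) hH
    simpa [measureReal_def] using this
  rw [hfun, integral_sub (integrable_const _)
    ((integrable_const _).indicator measurableSet_Iic), integral_indicator_const _
    measurableSet_Iic]
  simp only [integral_const, probReal_univ, smul_eq_mul]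
  linarith

lemma integrable_ite_Iic {μ : Measure ℝ} [IsProbabilityMeasure μ] (H : ℝ) :
    Integrable (fun x : ℝ => (if x ≤ H then 1 / 3 else 3 : ℝ)) μ := by
  refine Integrable.of_bound (C := 3) (Measurable.ite measurableSet_Iic measurable_const
    measurable_const).aestronglyMeasurable (ae_of_all _ fun x => ?_)
  split_ifs <;> norm_num

lemma succ_mul_five_ninths_pow_le {n : ℕ} (hn : 4 ≤ n) :
    ((n : ℝ) + 1) / 2 * (5 / 9) ^ n ≤ 1 := by
  induction n, hn using Nat.le_induction with
  | base => norm_num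
  | succ n hn ih =>
    refine le_trans ?_ ih
    have hn' : (4 : ℝ) ≤ n := by exact_mod_cast hn
    rw [pow_succ, ← mul_assoc, mul_right_comm]
    refine mul_le_mul_of_nonneg_right ?_ (by positivity)
    push_cast
    linarith

theorem average_case_ratio_bound
    (n : ℕ) (hn4 : 4 ≤ n) (hne : Even n) (tmin h : ℝ) (htmin : 0 < tmin) (hh : 0 < h)
    (hht : tmin ≤ h * tmin) (μ : Measure ℝ) [IsProbabilityMeasure μ]
    (hsupp : μ (Set.Ici tmin) = 1)
    (hcdf : (11 / 12 : ℝ≥0∞) ≤ μ (Set.Iic (h * tmin)))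
    (hwc : ∀ t : Fin n → ℝ, (∀ i, tmin ≤ t i) →
      SCMgen t (by omega) ≤
        (((n : ℝ) + 1) / 2) * Finset.univ.inf' ⟨⟨0, by omega⟩, Finset.mem_univ _⟩ t) :
    ∫ t : Fin n → ℝ,
        SCMgen t (by omega) / Finset.univ.inf' ⟨⟨0, by omega⟩, Finset.mem_univ _⟩ t
        ∂(Measure.pi (fun _ : Fin n => μ))
      < 2 * h + 1.33 := by
  have hn : 0 < n := by omega
  have hh1 : 1 ≤ h := by
    by_contra! hlt
    nlinarith
  set F : (Fin n → ℝ) → ℝ := fun t =>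
    SCMgen t hn / Finset.univ.inf' ⟨⟨0, hn⟩, Finset.mem_univ _⟩ t
  change ∫ t, F t ∂(Measure.pi fun _ : Fin n => μ) < _
  by_cases hF : Integrable F (Measure.pi fun _ : Fin n => μ)
  swap
  · rw [integral_undef hF]
    linarith
  set P : (Fin n → ℝ) → ℝ := fun t => ∏ i, if t i ≤ h * tmin then 1 / 3 else 3
  have hP : Integrable P (Measure.pi fun _ : Fin n => μ) :=
    Integrable.fintype_prod fun _ => integrable_ite_Iic (h * tmin)
  have hPint : ∫ t, P t ∂(Measure.pi fun _ : Fin n => μ) ≤ (5 / 9) ^ n := by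
    have hprod := integral_fintype_prod_eq_prod (𝕜 := ℝ) (μ := fun _ : Fin n => μ)
      (fun (_ : Fin n) (x : ℝ) => (if x ≤ h * tmin then 1 / 3 else 3 : ℝ))
    rw [Finset.prod_const, Finset.card_univ, Fintype.card_fin] at hprod
    refine hprod.le.trans (pow_le_pow_left₀ (integral_nonneg fun x => ?_)
      (integral_ite_Iic_le hcdf) n)
    dsimp only [Pi.zero_apply]
    split_ifs <;> norm_num
  have hae : ∀ᵐ t ∂(Measure.pi fun _ : Fin n => μ), ∀ i, tmin ≤ t i := by
    have hμ : ∀ᵐ x ∂μ, tmin ≤ x := (prob_compl_eq_zero_iff measurableSet_Ici).mpr hsupp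
    rw [ae_all_iff]
    intro i
    exact (Measure.quasiMeasurePreserving_eval (μ := fun _ : Fin n => μ) i).ae hμ
  have hle : ∀ᵐ t ∂(Measure.pi fun _ : Fin n => μ), F t ≤ 2 * h + ((n : ℝ) + 1) / 2 * P t := by
    filter_upwards [hae] with t ht
    have hm : tmin ≤ Finset.univ.inf' ⟨⟨0, hn⟩, Finset.mem_univ _⟩ t :=
      Finset.le_inf' _ _ fun i _ => ht i
    have hm0 := htmin.trans_le hm
    have hP0 : 0 ≤ P t := Finset.prod_nonneg fun i _ => by split_ifs <;> norm_num
    obtain ⟨r, hr⟩ := hne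
    rcases lt_or_ge (univ.filter fun i => t i ≤ h * tmin).card r with hlt | hge
    · have hP1 : 1 ≤ P t := one_le_prod_ite_of_card_lt hr hlt
      have hF1 : F t ≤ ((n : ℝ) + 1) / 2 := (div_le_iff₀ hm0).mpr (hwc t ht)
      have := le_mul_of_one_le_right (show (0 : ℝ) ≤ ((n : ℝ) + 1) / 2 by positivity) hP1
      linarith
    · obtain ⟨k, rfl⟩ : ∃ k, r = k + 2 := ⟨r - 2, by omega⟩
      set m := Finset.univ.inf' ⟨⟨0, hn⟩, Finset.mem_univ _⟩ t
      have hcard : k + 2 ≤ (univ.filter fun i => t i ≤ h * m).card := by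
        refine hge.trans (Finset.card_le_card fun i hi => ?_)
        simp only [Finset.mem_filter, Finset.mem_univ, true_and] at hi ⊢
        exact hi.trans (mul_le_mul_of_nonneg_left hm hh.le)
      have hS := SCMgen_le_of_le_card hn (fun i => htmin.trans_le (ht i))
        (le_mul_of_one_le_left hm0.le hh1) hcard
      have hF2 : F t ≤ 2 * h := by
        refine (div_le_iff₀ hm0).mpr (hS.trans_eq ?_)
        have hnr : (n : ℝ) = (k + 2) + (k + 2) := by exact_mod_cast hr
        rw [hnr]
        field_simp
        ring
      have : 0 ≤ ((n : ℝ) + 1) / 2 * P t := by positivity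
      linarith
  have hmono := integral_mono_ae hF ((integrable_const (2 * h)).add (hP.const_mul _)) hle
  simp only [Pi.add_apply] at hmono
  rw [integral_add (integrable_const _) (hP.const_mul _), integral_const_mul (_ : ℝ) P] at hmono
  simp only [integral_const, probReal_univ, smul_eq_mul, one_mul] at hmono
  have hbound := mul_le_mul_of_nonneg_left hPint
    (show (0 : ℝ) ≤ ((n : ℝ) + 1) / 2 by positivity)
  have hnum := succ_mul_five_ninths_pow_le hn4
  norm_num1
  linarith
end
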